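/- There exists a constant C = C(n) ≥ 1 such that: for every smooth solution Γ of the Yang–Mills flow on ℝⁿ × [0,T) whose spatial support is contained in a fixed compact set for all times, every z₀ = (x₀,t₀) with t₀ ∈ (0,T), and every R with 0 < 2R < √t₀/2, one has Ψ_{z₀}(R;Γ) ≤ C Φ_{z₀}(2R;Γ) and Φ_{z₀}(R;Γ) ≤ C Ψ_{z₀}(R;Γ). -/

import Mathlib

open MeasureTheory Filter Set
open scoped ContDiff ENNReal

noncomputable section

abbrev Mat (k : ℕ) := Fin k → Fin k → ℝ

def mmul {k : ℕ} (A B : Mat k) : Mat k := fun i j => ∑ l, A i l * B l j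

def mbra {k : ℕ} (A B : Mat k) : Mat k := mmul A B - mmul B A

def minner {k : ℕ} (A B : Mat k) : ℝ := ∑ i, ∑ j, A i j * B i j

def msq {k : ℕ} (A : Mat k) : ℝ := minner A A

abbrev Conn (n k : ℕ) := ℝ → (Fin n → ℝ) → Fin n → Mat k

/-- Spatial partial derivative in the `i`-th coordinate direction. -/
def pd {n : ℕ} {E : Type*} [NormedAddCommGroup E] [NormedSpace ℝ E]
    (f : (Fin n → ℝ) → E) (x : Fin n → ℝ) (i : Fin n) : E :=
  fderiv ℝ f x (Pi.single i 1)

/-- Time derivative of a time-dependent connection. -/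
def tderiv {n k : ℕ} (Γ : Conn n k) (t : ℝ) (x : Fin n → ℝ) (j : Fin n) : Mat k :=
  deriv (fun s => Γ s x j) t

/-- Curvature `(F_t)_{ij} = ∂_i(Γ_t)_j − ∂_j(Γ_t)_i + [(Γ_t)_i,(Γ_t)_j]`. -/
def curv {n k : ℕ} (Γ : Conn n k) (t : ℝ) (x : Fin n → ℝ) (i j : Fin n) : Mat k :=
  pd (fun y => Γ t y j) x i - pd (fun y => Γ t y i) x j + mbra (Γ t x i) (Γ t x j)

/-- Covariant derivative `∇_i om = ∂_i om + [(Γ_t)_i, om]`. -/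
def covD {n k : ℕ} (Γ : Conn n k) (t : ℝ) (om : (Fin n → ℝ) → Mat k)
    (x : Fin n → ℝ) (i : Fin n) : Mat k :=
  pd om x i + mbra (Γ t x i) (om x)

/-- A smooth time-dependent connection: jointly smooth in `(t,x)`, with values in the
skew-symmetric matrices `𝔤`. -/
def IsSmoothConn {n k : ℕ} (Γ : Conn n k) : Prop :=
  ContDiff ℝ ∞ (fun p : ℝ × (Fin n → ℝ) => Γ p.1 p.2)
    ∧ ∀ t x i a b, Γ t x i b a = - (Γ t x i a b)

/-- The Yang–Mills flow equation `∂_t(Γ_t)_j = Σᵢ ∇_i(F_t)_{ij}` on a time interval `I`. -/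
def IsYMFlowOn {n k : ℕ} (Γ : Conn n k) (I : Set ℝ) : Prop :=
  ∀ t ∈ I, ∀ x j, tderiv Γ t x j = ∑ i, covD Γ t (fun y => curv Γ t y i j) x i

/-- `|F_t|²(x) = Σ_{i,j} |(F_t)_{ij}(x)|²`. -/
def normF2 {n k : ℕ} (Γ : Conn n k) (t : ℝ) (x : Fin n → ℝ) : ℝ :=
  ∑ i, ∑ j, msq (curv Γ t x i j)

/-- The backwards heat kernel `G_{z₀}(x,t)` based at `z₀ = (x₀,t₀)`. -/
def gauss {n : ℕ} (z0 : (Fin n → ℝ) × ℝ) (x : Fin n → ℝ) (t : ℝ) : ℝ :=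
  (4 * Real.pi * (z0.2 - t)) ^ (-(n : ℝ) / 2) *
    Real.exp (-(∑ i, (x i - z0.1 i) ^ 2) / (4 * (z0.2 - t)))

/-- The entropy `Φ_{z₀}(R;Γ)`. -/
def Phi {n k : ℕ} (Γ : Conn n k) (z0 : (Fin n → ℝ) × ℝ) (R : ℝ) : ℝ :=
  R ^ 4 / 2 * ∫ x : Fin n → ℝ, normF2 Γ (z0.2 - R ^ 2) x * gauss z0 x (z0.2 - R ^ 2)

/-- The entropy `Ψ_{z₀}(R;Γ)`. -/
def Psi {n k : ℕ} (Γ : Conn n k) (z0 : (Fin n → ℝ) × ℝ) (R : ℝ) : ℝ :=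
  R ^ 2 / 2 * ∫ t in Icc (z0.2 - 4 * R ^ 2) (z0.2 - R ^ 2),
    ∫ x : Fin n → ℝ, normF2 Γ t x * gauss z0 x t

/-- The parabolically rescaled connection `Γ^{λ,z₀}`. -/
def rescale {n k : ℕ} (Γ : Conn n k) (z0 : (Fin n → ℝ) × ℝ) (lam : ℝ) : Conn n k :=
  fun t x i => lam • Γ (lam ^ 2 * t + z0.2) (fun m => lam * x m + z0.1 m) i

/-- Spatial support of `Γ_t` contained in `K` for all `t`. -/
def SuppIn {n k : ℕ} (Γ : Conn n k) (K : Set (Fin n → ℝ)) : Prop :=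
  ∀ t x, x ∉ K → Γ t x = 0

section Algebra

variable {k : ℕ}

lemma mmul_eq_matrix_mul (A B : Mat k) :
    mmul A B = (show Matrix (Fin k) (Fin k) ℝ from A) * (show Matrix (Fin k) (Fin k) ℝ from B) := by
  ext i j
  rw [Matrix.mul_apply]
  rfl

lemma minner_eq_trace (A B : Mat k) :
    minner A B = ((show Matrix (Fin k) (Fin k) ℝ from A).transpose *
      (show Matrix (Fin k) (Fin k) ℝ from B)).trace := by
  rw [Matrix.trace, minner, Finset.sum_comm]
  rfl

/-- The commutator of matrices as a continuous bilinear map. -/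
def mbraL (k : ℕ) : Mat k →L[ℝ] Mat k →L[ℝ] Mat k :=
  (LinearMap.mk₂ ℝ (fun A B : Mat k => mbra A B)
    (fun A A' B => by
      ext; simp only [mbra, mmul, Pi.sub_apply, Pi.add_apply, add_mul, mul_add,
        Finset.sum_add_distrib]; ring)
    (fun c A B => by
      ext; simp only [mbra, mmul, Pi.sub_apply, Pi.smul_apply, smul_eq_mul, Finset.mul_sum,
        mul_sub, mul_assoc, mul_left_comm c])
    (fun A B B' => by
      ext; simp only [mbra, mmul, Pi.sub_apply, Pi.add_apply, add_mul, mul_add,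
        Finset.sum_add_distrib]; ring)
    (fun c A B => by
      ext; simp only [mbra, mmul, Pi.sub_apply, Pi.smul_apply, smul_eq_mul, Finset.mul_sum,
        mul_sub, mul_assoc, mul_left_comm c])).toContinuousBilinearMap

lemma mbraL_apply (A B : Mat k) : mbraL k A B = mbra A B := rfl

/-- The inner product of matrices as a continuous bilinear map. -/
def minnerL (k : ℕ) : Mat k →L[ℝ] Mat k →L[ℝ] ℝ :=
  (LinearMap.mk₂ ℝ (fun A B : Mat k => minner A B)
    (fun A A' B => by
      simp only [minner, Pi.add_apply, add_mul, Finset.sum_add_distrib])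
    (fun c A B => by
      simp only [minner, Pi.smul_apply, smul_eq_mul, Finset.mul_sum, mul_assoc])
    (fun A B B' => by
      simp only [minner, Pi.add_apply, mul_add, Finset.sum_add_distrib])
    (fun c A B => by
      simp only [minner, Pi.smul_apply, smul_eq_mul, Finset.mul_sum,
        mul_left_comm c])).toContinuousBilinearMap

lemma minnerL_apply (A B : Mat k) : minnerL k A B = minner A B := rfl

lemma minner_comm (A B : Mat k) : minner A B = minner B A := by
  simp only [minner, mul_comm]

lemma msq_nonneg (A : Mat k) : 0 ≤ msq A := by
  unfold msq minner
  exact Finset.sum_nonneg fun _ _ => Finset.sum_nonneg fun _ _ => mul_self_nonneg _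

lemma mbra_swap (A B : Mat k) : mbra A B = -mbra B A := by
  simp [mbra]

lemma mbra_jacobi (A B C : Mat k) :
    mbra A (mbra B C) + mbra B (mbra C A) + mbra C (mbra A B) = 0 := by
  simp only [mbra, mmul_eq_matrix_mul]
  have key : ∀ A B C : Matrix (Fin k) (Fin k) ℝ,
      A * (B * C - C * B) - (B * C - C * B) * A + (B * (C * A - A * C) - (C * A - A * C) * B)
        + (C * (A * B - B * A) - (A * B - B * A) * C) = 0 := by
    intro A B C
    noncomm_ring
  exact key A B C

lemma minner_mbra_left {S : Mat k} (hS : ∀ a b, S b a = -S a b) (A B : Mat k) :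
    minner (mbra S A) B = -minner A (mbra S B) := by
  have key : ∀ S A B : Matrix (Fin k) (Fin k) ℝ, S.transpose = -S →
      ((S * A - A * S).transpose * B).trace = -(A.transpose * (S * B - B * S)).trace := by
    intro S A B h
    rw [Matrix.transpose_sub, Matrix.transpose_mul, Matrix.transpose_mul, h, sub_mul, mul_sub,
      Matrix.trace_sub, Matrix.trace_sub, mul_assoc, neg_mul, neg_mul, neg_mul, mul_neg,
      Matrix.trace_neg, Matrix.trace_neg, mul_assoc, Matrix.trace_mul_comm S (A.transpose * B),
      mul_assoc]
    ring
  simp only [minner_eq_trace, mbra, mmul_eq_matrix_mul]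
  exact key S A B (by ext a b; exact hS a b)

end Algebra

section SpaceTime

variable {P : Type*} [NormedAddCommGroup P] [NormedSpace ℝ P] {k : ℕ}

/-- Curvature component in the directions `v, w` of a connection whose components in these
directions are `a, b`. -/
def dirCurv (v w : P) (a b : P → Mat k) (p : P) : Mat k :=
  fderiv ℝ b p v - fderiv ℝ a p w + mbra (a p) (b p)

/-- Covariant derivative in the direction `v` of a connection whose component in that
direction is `a`. -/
def dirCov (v : P) (a om : P → Mat k) (p : P) : Mat k :=
  fderiv ℝ om p v + mbra (a p) (om p)

lemma ContDiff.fderiv_dir {E : Type*} [NormedAddCommGroup E] [NormedSpace ℝ E] {f : P → E}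
    (hf : ContDiff ℝ ∞ f) (v : P) : ContDiff ℝ ∞ fun p => fderiv ℝ f p v :=
  (hf.fderiv_right (m := ∞) (by simp)).clm_apply contDiff_const

lemma ContDiff.mbra {a b : P → Mat k} (ha : ContDiff ℝ ∞ a) (hb : ContDiff ℝ ∞ b) :
    ContDiff ℝ ∞ fun p => mbra (a p) (b p) :=
  ((mbraL k).contDiff.comp ha).clm_apply hb

lemma ContDiff.minner {a b : P → Mat k} (ha : ContDiff ℝ ∞ a) (hb : ContDiff ℝ ∞ b) :
    ContDiff ℝ ∞ fun p => minner (a p) (b p) :=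
  ((minnerL k).contDiff.comp ha).clm_apply hb

lemma ContDiff.dirCurv {a b : P → Mat k} (ha : ContDiff ℝ ∞ a) (hb : ContDiff ℝ ∞ b) (v w : P) :
    ContDiff ℝ ∞ (dirCurv v w a b) :=
  ((hb.fderiv_dir v).sub (ha.fderiv_dir w)).add (ha.mbra hb)

lemma fderiv_fderiv_comm {E : Type*} [NormedAddCommGroup E] [NormedSpace ℝ E] {f : P → E}
    (hf : ContDiff ℝ ∞ f) (p v w : P) :
    fderiv ℝ (fun q => fderiv ℝ f q v) p w = fderiv ℝ (fun q => fderiv ℝ f q w) p v := by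
  have hd : DifferentiableAt ℝ (fderiv ℝ f) p :=
    (hf.fderiv_right (m := ∞) (by simp)).differentiable (by simp) p
  have hs : IsSymmSndFDerivAt ℝ f p :=
    (contDiff_infty.1 hf 2).contDiffAt.isSymmSndFDerivAt (by simp)
  have h : ∀ u z : P, fderiv ℝ (fun q => fderiv ℝ f q u) p z = fderiv ℝ (fderiv ℝ f) p z u := by
    intro u z
    rw [fderiv_clm_apply hd (differentiableAt_const u)]
    simp
  rw [h, h, hs.eq]

lemma fderiv_mbra {a b : P → Mat k} (ha : ContDiff ℝ ∞ a) (hb : ContDiff ℝ ∞ b) (p v : P) :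
    fderiv ℝ (fun q => mbra (a q) (b q)) p v
      = mbra (fderiv ℝ a p v) (b p) + mbra (a p) (fderiv ℝ b p v) := by
  have h := (mbraL k).hasFDerivAt_of_bilinear (ha.differentiable (by simp) p).hasFDerivAt
    (hb.differentiable (by simp) p).hasFDerivAt
  have h' := h.fderiv
  simp only [mbraL_apply] at h'
  rw [h']
  simp [mbraL_apply, add_comm]

lemma fderiv_dirCurv {a b : P → Mat k} (ha : ContDiff ℝ ∞ a) (hb : ContDiff ℝ ∞ b)
    (p u v w : P) :
    fderiv ℝ (dirCurv v w a b) p u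
      = fderiv ℝ (fun q => fderiv ℝ b q v) p u - fderiv ℝ (fun q => fderiv ℝ a q w) p u
        + (mbra (fderiv ℝ a p u) (b p) + mbra (a p) (fderiv ℝ b p u)) := by
  have h1 := (hb.fderiv_dir v).differentiable (by simp) p
  have h2 := (ha.fderiv_dir w).differentiable (by simp) p
  have h3 := (ha.mbra hb).differentiable (by simp) p
  rw [← fderiv_mbra ha hb]
  have : dirCurv v w a b = fun q => fderiv ℝ b q v - fderiv ℝ a q w + mbra (a q) (b q) := rfl
  rw [this, fderiv_fun_add (h1.fun_sub h2) h3, fderiv_fun_sub h1 h2]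
  rfl

/-- The second Bianchi identity. -/
lemma dirCov_dirCurv_cyclic {a b c : P → Mat k} (ha : ContDiff ℝ ∞ a) (hb : ContDiff ℝ ∞ b)
    (hc : ContDiff ℝ ∞ c) (u v w p : P) :
    dirCov u a (dirCurv v w b c) p + dirCov v b (dirCurv w u c a) p
      + dirCov w c (dirCurv u v a b) p = 0 := by
  simp only [dirCov, fderiv_dirCurv ha hb, fderiv_dirCurv hb hc, fderiv_dirCurv hc ha,
    fderiv_fderiv_comm ha p v w, fderiv_fderiv_comm hb p w u, fderiv_fderiv_comm hc p u v]
  have hj := mbra_jacobi (a p) (b p) (c p)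
  simp only [dirCurv, ← mbraL_apply, map_add, map_sub] at hj ⊢
  have hs : ∀ A B : Mat k, mbraL k A B = -mbraL k B A := mbra_swap
  rw [hs (fderiv ℝ b p u), hs (fderiv ℝ c p v), hs (fderiv ℝ a p w), ← sub_eq_zero.2 hj]
  abel

lemma dirCurv_swap (v w : P) (a b : P → Mat k) (p : P) :
    dirCurv v w a b p = -dirCurv w v b a p := by
  rw [dirCurv, dirCurv, mbra_swap]
  abel

end SpaceTime

section Slices

variable {X E : Type*} [NormedAddCommGroup X] [NormedSpace ℝ X] [NormedAddCommGroup E]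
  [NormedSpace ℝ E]

lemma fderiv_slice_right {f : ℝ × X → E} {t : ℝ} {x : X} (hf : DifferentiableAt ℝ f (t, x))
    (v : X) : fderiv ℝ (fun y => f (t, y)) x v = fderiv ℝ f (t, x) (0, v) := by
  have h := hf.hasFDerivAt.comp x (hasFDerivAt_prodMk_right (𝕜 := ℝ) t x)
  rw [show (fun y => f (t, y)) = f ∘ Prod.mk t from rfl, h.fderiv]
  simp

lemma hasDerivAt_slice_left {f : ℝ × X → E} {t : ℝ} {x : X}
    (hf : DifferentiableAt ℝ f (t, x)) :
    HasDerivAt (fun s => f (s, x)) (fderiv ℝ f (t, x) (1, 0)) t := by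
  have h := hf.hasFDerivAt.comp t (hasFDerivAt_prodMk_left (𝕜 := ℝ) t x)
  simpa using! h.hasDerivAt

lemma hasDerivAt_line {f : X → E} {p : X} (hf : DifferentiableAt ℝ f p) (v : X) :
    HasDerivAt (fun s : ℝ => f (p + s • v)) (fderiv ℝ f p v) 0 :=
  hf.hasFDerivAt.hasLineDerivAt v

end Slices

section Integration

variable {X : Type*} [NormedAddCommGroup X] [NormedSpace ℝ X] [MeasurableSpace X] [BorelSpace X]
  (μ : Measure X)

lemma integral_fderiv_eq_zero [FiniteDimensional ℝ X] [μ.IsAddHaarMeasure] {f : X → ℝ}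
    (hf : ContDiff ℝ 1 f) (hc : HasCompactSupport f) (v : X) : ∫ x, fderiv ℝ f x v ∂μ = 0 := by
  have hd : Integrable (fun x => fderiv ℝ f x v) μ :=
    ((hf.continuous_fderiv (by simp)).clm_apply continuous_const).integrable_of_hasCompactSupport
      (hc.fderiv_apply (𝕜 := ℝ) v)
  have hi : Integrable f μ := hf.continuous.integrable_of_hasCompactSupport hc
  have h := integral_mul_fderiv_eq_neg_fderiv_mul_of_integrable (μ := μ) (f := fun _ : X => (1 : ℝ))
    (g := f) (v := v) (by simp) (by simpa using hd) (by simpa using hi)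
    (fun x _ => differentiableAt_const _) (fun x _ => hf.differentiable (by simp) x)
  simpa using h

/-- Differentiation under the integral sign for functions with compact support in space. -/
lemma hasDerivAt_integral_of_contDiffOn [IsFiniteMeasureOnCompacts μ] {u : ℝ × X → ℝ}
    {I : Set ℝ} (hI : IsOpen I) (hu : ContDiffOn ℝ 1 u (I ×ˢ univ)) {K : Set X} (hK : IsCompact K)
    (hs : ∀ t, ∀ x, x ∉ K → u (t, x) = 0) {t : ℝ} (ht : t ∈ I) :
    Integrable (fun x => fderiv ℝ u (t, x) (1, 0)) μ ∧
      HasDerivAt (fun s => ∫ x, u (s, x) ∂μ) (∫ x, fderiv ℝ u (t, x) (1, 0) ∂μ) t := by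
  have hopen : IsOpen (I ×ˢ (univ : Set X)) := hI.prod isOpen_univ
  have hslice : ∀ s ∈ I, Continuous fun x => u (s, x) := fun s hs' =>
    continuous_iff_continuousAt.2 fun x =>
      ((hu.continuousOn.continuousAt (hopen.mem_nhds ⟨hs', mem_univ x⟩)).comp
        (Continuous.prodMk_right s).continuousAt)
  have hdu : ContinuousOn (fun p => fderiv ℝ u p (1, 0)) (I ×ˢ univ) :=
    (hu.continuousOn_fderiv_of_isOpen hopen le_rfl).clm_apply continuousOn_const
  have hdiff : ∀ s ∈ I, ∀ x, HasDerivAt (fun r => u (r, x)) (fderiv ℝ u (s, x) (1, 0)) s :=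
    fun s hs' x => hasDerivAt_slice_left
      ((hu.contDiffAt (hopen.mem_nhds ⟨hs', mem_univ x⟩)).differentiableAt (by simp))
  have hzero : ∀ s ∈ I, ∀ x, x ∉ K → fderiv ℝ u (s, x) (1, 0) = 0 := by
    intro s hs' x hx
    have h0 : (fun r => u (r, x)) = fun _ => 0 := funext fun r => hs r x hx
    have h := hdiff s hs' x
    rw [h0] at h
    exact h.unique (hasDerivAt_const s 0)
  obtain ⟨ε, hε, hball⟩ := Metric.nhds_basis_closedBall.mem_iff.1 (hI.mem_nhds ht)
  obtain ⟨M, hM⟩ := ((isCompact_closedBall t ε).prod hK).exists_bound_of_continuousOn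
    (hdu.mono (prod_mono hball (subset_univ K)))
  refine hasDerivAt_integral_of_dominated_loc_of_deriv_le
    (F := fun s x => u (s, x)) (F' := fun s x => fderiv ℝ u (s, x) (1, 0))
    (bound := K.indicator fun _ => M) (Metric.closedBall_mem_nhds t hε) ?_ ?_ ?_ ?_ ?_ ?_
  · filter_upwards [hI.mem_nhds ht] with s hs'
    exact (hslice s hs').aestronglyMeasurable
  · exact (hslice t ht).integrable_of_hasCompactSupport (HasCompactSupport.intro hK (hs t))
  · have hc : Continuous fun x => fderiv ℝ u (t, x) (1, 0) :=
      continuous_iff_continuousAt.2 fun x =>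
        (hdu.continuousAt (hopen.mem_nhds ⟨ht, mem_univ x⟩)).comp
          (f := fun y => (t, y)) (Continuous.prodMk_right t).continuousAt
    exact hc.aestronglyMeasurable
  · refine ae_of_all _ fun x s hs' => ?_
    by_cases hx : x ∈ K
    · rw [indicator_of_mem hx]
      exact hM (s, x) ⟨hs', hx⟩
    · rw [indicator_of_notMem hx, hzero s (hball hs') x hx, norm_zero]
  · exact (integrable_indicator_iff hK.measurableSet).2
      (integrableOn_const hK.measure_lt_top.ne)
  · exact ae_of_all _ fun x s hs' => hdiff s (hball hs') x

end Integration

section Kernel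

variable {n : ℕ} (x0 : Fin n → ℝ) (t0 : ℝ)

lemma gauss_pos {t : ℝ} (ht : t < t0) (x : Fin n → ℝ) : 0 < gauss (x0, t0) x t := by
  have : 0 < t0 - t := sub_pos.2 ht
  unfold gauss
  positivity

lemma contDiffOn_gauss :
    ContDiffOn ℝ ∞ (fun p : ℝ × (Fin n → ℝ) => gauss (x0, t0) p.2 p.1) (Iio t0 ×ˢ univ) := by
  have h : ∀ p ∈ Iio t0 ×ˢ (univ : Set (Fin n → ℝ)), 0 < t0 - p.1 := fun p hp => sub_pos.2 hp.1
  unfold gauss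
  refine ContDiffOn.mul (ContDiffOn.rpow_const_of_ne (by fun_prop) fun p hp => ?_)
    (ContDiffOn.exp (ContDiffOn.div (by fun_prop) (by fun_prop) fun p hp => ?_))
  · have := h p hp
    positivity
  · have := h p hp
    positivity

lemma contDiff_gauss_slice {t : ℝ} (ht : t < t0) : ContDiff ℝ ∞ fun y => gauss (x0, t0) y t := by
  refine contDiff_iff_contDiffAt.2 fun y => ?_
  have hmem : Iio t0 ×ˢ univ ∈ nhds (t, y) :=
    (isOpen_Iio.prod isOpen_univ).mem_nhds ⟨ht, mem_univ y⟩
  exact ((contDiffOn_gauss x0 t0).contDiffAt hmem).comp y (contDiff_prodMk_right t).contDiffAt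

lemma hasDerivAt_gauss_time {t : ℝ} (ht : t < t0) (x : Fin n → ℝ) :
    HasDerivAt (fun s => gauss (x0, t0) x s)
      (gauss (x0, t0) x t * (n / (2 * (t0 - t)) - (∑ i, (x i - x0 i) ^ 2) / (4 * (t0 - t) ^ 2)))
      t := by
  have hτ : 0 < t0 - t := sub_pos.2 ht
  have hsub : HasDerivAt (fun s => t0 - s) (-1) t := by
    simpa using (hasDerivAt_id t).const_sub t0
  have h1 := (hsub.const_mul (4 * Real.pi)).rpow_const (p := -(n : ℝ) / 2)
    (Or.inl (by positivity))
  have h2 := ((hasDerivAt_const t (-(∑ i, (x i - x0 i) ^ 2))).div (hsub.const_mul 4)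
    (by positivity)).exp
  refine (h1.mul h2).congr_deriv ?_
  simp only [gauss]
  rw [Real.rpow_sub_one (by positivity)]
  simp only [Pi.div_apply]
  field_simp
  ring

lemma hasDerivAt_gauss_line {t : ℝ} (ht : t < t0) (x : Fin n → ℝ) (i : Fin n) :
    HasDerivAt (fun s : ℝ => gauss (x0, t0) (x + s • Pi.single i (1 : ℝ)) t)
      (gauss (x0, t0) x t * (-((x i - x0 i) / (2 * (t0 - t))))) 0 := by
  have hτ : 0 < t0 - t := sub_pos.2 ht
  have hq : HasDerivAt (fun s : ℝ => ∑ j, ((x + s • (Pi.single i 1 : Fin n → ℝ)) j - x0 j) ^ 2)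
      (2 * (x i - x0 i)) 0 := by
    have h : ∀ j, HasDerivAt (fun s : ℝ => ((x + s • (Pi.single i 1 : Fin n → ℝ)) j - x0 j) ^ 2)
        (if j = i then 2 * (x i - x0 i) else 0) 0 := by
      intro j
      have h1 : HasDerivAt (fun s : ℝ => x j + s * (Pi.single i (1 : ℝ) : Fin n → ℝ) j - x0 j)
          ((Pi.single i (1 : ℝ) : Fin n → ℝ) j) 0 := by
        simpa using (((hasDerivAt_id (0 : ℝ)).mul_const
          ((Pi.single i (1 : ℝ) : Fin n → ℝ) j)).const_add (x j)).sub_const (x0 j)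
      refine (h1.pow 2).congr_deriv ?_
      by_cases hj : j = i
      · subst hj; simp
      · simp [hj]
    refine (HasDerivAt.fun_sum fun j (_ : j ∈ Finset.univ) => h j).congr_deriv ?_
    simp
  have h := ((hq.neg.div_const (4 * (t0 - t))).exp).const_mul
    ((4 * Real.pi * (t0 - t)) ^ (-(n : ℝ) / 2))
  refine h.congr_deriv ?_
  simp only [gauss, zero_smul, add_zero, Pi.neg_apply]
  field_simp
  ring

end Kernel

section DivergenceIdentity

variable {n k : ℕ}

lemma minner_add_left (A B C : Mat k) : minner (A + B) C = minner A C + minner B C := by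
  simp only [← minnerL_apply, map_add, add_apply]

lemma minner_sub_right (A B C : Mat k) : minner A (B - C) = minner A B - minner A C := by
  simp only [← minnerL_apply, map_sub]

lemma minner_neg_left (A B : Mat k) : minner (-A) B = -minner A B := by
  simp only [← minnerL_apply, map_neg, neg_apply]

lemma minner_neg_right (A B : Mat k) : minner A (-B) = -minner A B := by
  simp only [← minnerL_apply, map_neg]

lemma minner_smul_left (c : ℝ) (A B : Mat k) : minner (c • A) B = c * minner A B := by
  simp only [← minnerL_apply, map_smul, smul_apply, smul_eq_mul]

lemma minner_sum_left {ι : Type*} (s : Finset ι) (f : ι → Mat k) (A : Mat k) :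
    minner (∑ i ∈ s, f i) A = ∑ i ∈ s, minner (f i) A := by
  simp only [← minnerL_apply, map_sum, sum_apply]

lemma minner_sum_right {ι : Type*} (s : Finset ι) (f : ι → Mat k) (A : Mat k) :
    minner A (∑ i ∈ s, f i) = ∑ i ∈ s, minner A (f i) := by
  simp only [← minnerL_apply, map_sum]

lemma msq_sub_smul (c : ℝ) (A B : Mat k) :
    msq (A - c • B) = msq A - 2 * c * minner B A + c ^ 2 * msq B := by
  simp only [msq, ← minnerL_apply, map_sub, map_smul, sub_apply,
    smul_apply, smul_eq_mul]
  simp only [minnerL_apply, minner_comm A B]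
  ring

lemma sum_minner_antisymm {F dE : Fin n → Fin n → Mat k} (hF : ∀ i j, F i j = -F j i) :
    ∑ i, ∑ j, minner (F i j) (dE i j - dE j i) = 2 * ∑ i, ∑ j, minner (F i j) (dE i j) := by
  have h : ∑ i, ∑ j, minner (F i j) (dE j i) = -∑ i, ∑ j, minner (F i j) (dE i j) := by
    rw [Finset.sum_comm, ← Finset.sum_neg_distrib]
    refine Finset.sum_congr rfl fun i _ => ?_
    rw [← Finset.sum_neg_distrib]
    refine Finset.sum_congr rfl fun j _ => ?_
    rw [hF j i, minner_neg_left]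
  simp only [minner_sub_right, Finset.sum_sub_distrib, h]
  ring

lemma sum_minner_bianchi {F : Fin n → Fin n → Mat k} {dF : Fin n → Fin n → Fin n → Mat k}
    (hF : ∀ i j, F i j = -F j i) (hdF : ∀ l i j, dF l i j = -dF l j i)
    (hB : ∀ l i j, dF l i j + dF i j l + dF j l i = 0) (l : Fin n) :
    ∑ a, ∑ b, minner (dF l a b) (F a b) = 2 * ∑ i, ∑ j, minner (dF i l j) (F i j) := by
  have h : ∀ a b, minner (dF l a b) (F a b)
      = minner (dF a l b) (F a b) + minner (dF b l a) (F b a) := by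
    intro a b
    have h1 : dF l a b = dF a l b + -dF b l a := by
      rw [hdF a l b, eq_neg_of_add_eq_zero_left ((add_assoc _ _ _).symm.trans (hB l a b))]
      abel
    rw [h1, minner_add_left, minner_neg_left, hF b a, minner_neg_right]
  simp only [h, Finset.sum_add_distrib]
  rw [Finset.sum_comm (f := fun a b => minner (dF b l a) (F b a))]
  ring

/-- The algebraic identity behind the monotonicity formula: `F`, `E` and their covariant
derivatives `dF`, `dE` are the curvature and its divergence at a point, `y` is the position
relative to the centre of the heat kernel and `r` is half the inverse backward time. -/
lemma sum_divergence_eq {F dE : Fin n → Fin n → Mat k} {E : Fin n → Mat k}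
    {dF : Fin n → Fin n → Fin n → Mat k} (y : Fin n → ℝ) (r : ℝ)
    (hF : ∀ i j, F i j = -F j i) (hdF : ∀ l i j, dF l i j = -dF l j i)
    (hB : ∀ l i j, dF l i j + dF i j l + dF j l i = 0) (hE : ∀ j, E j = ∑ i, dF i i j) :
    ∑ i, ((4 * ∑ j, (minner (dF i i j) (E j) + minner (F i j) (dE i j))
        + (r * ∑ a, ∑ b, msq (F a b)
          + r * y i * ∑ a, ∑ b, (minner (dF i a b) (F a b) + minner (F a b) (dF i a b)))
        - 4 * r * ∑ j, (minner (F i j + ∑ l, y l • dF i l j) (F i j)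
            + minner (∑ l, y l • F l j) (dF i i j)))
      - r * y i * (4 * ∑ j, minner (F i j) (E j) + r * y i * ∑ a, ∑ b, msq (F a b)
        - 4 * r * ∑ j, minner (∑ l, y l • F l j) (F i j)))
    = 2 * ∑ i, ∑ j, minner (F i j) (dE i j - dE j i)
      + (∑ a, ∑ b, msq (F a b)) * (n * r - r ^ 2 * ∑ i, y i ^ 2 - 4 * r)
      + 4 * ∑ j, msq (E j - r • ∑ l, y l • F l j) := by
  have h1 : ∑ i, ∑ j, minner (dF i i j) (E j) = ∑ j, msq (E j) := by
    rw [Finset.sum_comm]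
    simp only [← minner_sum_left, ← hE, msq]
  have h3 : ∑ i, y i * ∑ a, ∑ b, minner (dF i a b) (F a b)
      = 2 * ∑ i, ∑ j, minner (∑ l, y l • dF i l j) (F i j) := by
    simp only [sum_minner_bianchi hF hdF hB, minner_sum_left, minner_smul_left]
    have h : ∀ i, ∑ j, ∑ l, y l * minner (dF i l j) (F i j)
        = ∑ l, y l * ∑ j, minner (dF i l j) (F i j) := by
      intro i
      rw [Finset.sum_comm]
      simp only [Finset.mul_sum]
    simp only [h]
    rw [Finset.sum_comm]
    simp only [← Finset.mul_sum]
    rw [Finset.mul_sum]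
    exact Finset.sum_congr rfl fun l _ => by ring
  have h4 : ∑ i, ∑ j, minner (∑ l, y l • F l j) (dF i i j)
      = ∑ j, minner (∑ l, y l • F l j) (E j) := by
    rw [Finset.sum_comm]
    simp only [← minner_sum_right, ← hE]
  have h5 : ∑ i, y i * ∑ j, minner (F i j) (E j) = ∑ j, minner (∑ l, y l • F l j) (E j) := by
    simp only [Finset.mul_sum, minner_sum_left, minner_smul_left]
    rw [Finset.sum_comm]
  have h6 : ∑ i, y i * ∑ j, minner (∑ l, y l • F l j) (F i j)
      = ∑ j, msq (∑ l, y l • F l j) := by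
    have h : ∀ j, msq (∑ l, y l • F l j) = ∑ i, y i * minner (∑ l, y l • F l j) (F i j) := by
      intro j
      rw [msq]
      conv_lhs => enter [2]
      rw [minner_sum_right]
      refine Finset.sum_congr rfl fun i _ => ?_
      rw [minner_comm, minner_smul_left, minner_comm]
    simp only [h]
    simp only [Finset.mul_sum]
    rw [Finset.sum_comm]
  have h7 : ∑ i, ∑ j, minner (F i j) (F i j) = ∑ a, ∑ b, msq (F a b) := rfl
  rw [sum_minner_antisymm hF]
  simp only [minner_comm (F _ _) (dF _ _ _), msq_sub_smul, minner_add_left]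
  have hL : ∀ i, ((4 * ∑ j, (minner (dF i i j) (E j) + minner (F i j) (dE i j))
        + (r * ∑ a, ∑ b, msq (F a b)
          + r * y i * ∑ a, ∑ b, (minner (dF i a b) (F a b) + minner (dF i a b) (F a b)))
        - 4 * r * ∑ j, (minner (F i j) (F i j) + minner (∑ l, y l • dF i l j) (F i j)
            + minner (∑ l, y l • F l j) (dF i i j)))
      - r * y i * (4 * ∑ j, minner (F i j) (E j) + r * y i * ∑ a, ∑ b, msq (F a b)
        - 4 * r * ∑ j, minner (∑ l, y l • F l j) (F i j)))
      = 4 * ∑ j, minner (dF i i j) (E j) + 4 * ∑ j, minner (F i j) (dE i j)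
        + r * ∑ a, ∑ b, msq (F a b) + 2 * r * (y i * ∑ a, ∑ b, minner (dF i a b) (F a b))
        - 4 * r * ∑ j, minner (F i j) (F i j)
        - 4 * r * ∑ j, minner (∑ l, y l • dF i l j) (F i j)
        - 4 * r * ∑ j, minner (∑ l, y l • F l j) (dF i i j)
        - 4 * r * (y i * ∑ j, minner (F i j) (E j))
        - r ^ 2 * (∑ a, ∑ b, msq (F a b)) * y i ^ 2
        + 4 * r ^ 2 * (y i * ∑ j, minner (∑ l, y l • F l j) (F i j)) := by
    intro i
    simp only [Finset.sum_add_distrib]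
    ring
  simp only [hL]
  simp only [Finset.sum_add_distrib, Finset.sum_sub_distrib, ← Finset.mul_sum, h1, h3, h4, h5, h6,
    h7, Finset.sum_const, Finset.card_univ, Fintype.card_fin, nsmul_eq_mul]
  ring

end DivergenceIdentity

section Flow

variable {n k : ℕ} {Γ : Conn n k}

/-- Curvature components as functions on space-time. -/
def stCurv (Γ : Conn n k) (i j : Fin n) : ℝ × (Fin n → ℝ) → Mat k :=
  dirCurv (0, Pi.single i 1) (0, Pi.single j 1) (fun p => Γ p.1 p.2 i) (fun p => Γ p.1 p.2 j)

/-- Time derivative of the connection as a function on space-time. -/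
def stVel (Γ : Conn n k) (j : Fin n) (p : ℝ × (Fin n → ℝ)) : Mat k :=
  fderiv ℝ (fun p : ℝ × (Fin n → ℝ) => Γ p.1 p.2 j) p (1, 0)

/-- Spatial covariant derivative of a function on space-time. -/
def stCov (Γ : Conn n k) (i : Fin n) (om : ℝ × (Fin n → ℝ) → Mat k) :
    ℝ × (Fin n → ℝ) → Mat k :=
  dirCov (0, Pi.single i 1) (fun p => Γ p.1 p.2 i) om

lemma IsSmoothConn.component (h : IsSmoothConn Γ) (i : Fin n) :
    ContDiff ℝ ∞ fun p : ℝ × (Fin n → ℝ) => Γ p.1 p.2 i :=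
  contDiff_pi.1 h.1 i

lemma IsSmoothConn.stCurv (h : IsSmoothConn Γ) (i j : Fin n) : ContDiff ℝ ∞ (stCurv Γ i j) :=
  (h.component i).dirCurv (h.component j) _ _

lemma IsSmoothConn.stVel (h : IsSmoothConn Γ) (j : Fin n) : ContDiff ℝ ∞ (stVel Γ j) :=
  (h.component j).fderiv_dir _

lemma curv_eq_stCurv (h : IsSmoothConn Γ) (t : ℝ) (x : Fin n → ℝ) (i j : Fin n) :
    curv Γ t x i j = stCurv Γ i j (t, x) := by
  have hd : ∀ i, DifferentiableAt ℝ (fun p : ℝ × (Fin n → ℝ) => Γ p.1 p.2 i) (t, x) :=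
    fun i => (h.component i).differentiable (by simp) _
  simp only [curv, stCurv, dirCurv, pd, ← fderiv_slice_right (hd _)]

lemma normF2_eq (h : IsSmoothConn Γ) (t : ℝ) (x : Fin n → ℝ) :
    normF2 Γ t x = ∑ i, ∑ j, msq (stCurv Γ i j (t, x)) := by
  simp only [normF2, curv_eq_stCurv h]

lemma IsYMFlowOn.stVel_eq (h : IsSmoothConn Γ) {I : Set ℝ} (hflow : IsYMFlowOn Γ I) {t : ℝ}
    (ht : t ∈ I) (x : Fin n → ℝ) (j : Fin n) :
    stVel Γ j (t, x) = ∑ i, stCov Γ i (stCurv Γ i j) (t, x) := by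
  have h1 : tderiv Γ t x j = stVel Γ j (t, x) :=
    (hasDerivAt_slice_left ((h.component j).differentiable (by simp) (t, x))).deriv
  rw [← h1, hflow t ht x j]
  refine Finset.sum_congr rfl fun i _ => ?_
  simp only [covD, curv_eq_stCurv h, stCov, dirCov, pd]
  rw [fderiv_slice_right ((h.stCurv i j).differentiable (by simp) (t, x))]

lemma stCurv_eq_zero {K : Set (Fin n → ℝ)} (hK : IsCompact K) (hs : SuppIn Γ K)
    (h : IsSmoothConn Γ) (t : ℝ) {x : Fin n → ℝ} (hx : x ∉ K) (i j : Fin n) :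
    stCurv Γ i j (t, x) = 0 := by
  have hev : ∀ i, (fun y => Γ t y i) =ᶠ[nhds x] fun _ => 0 := by
    intro i
    filter_upwards [hK.isClosed.isOpen_compl.mem_nhds hx] with y hy
    rw [hs t y hy]
    rfl
  have hx0 : Γ t x i = 0 := by rw [hs t x hx]; rfl
  rw [← curv_eq_stCurv h]
  simp only [curv, pd, (hev _).fderiv_eq, hx0, ← mbraL_apply]
  simp

lemma stCurv_swap (i j : Fin n) (p : ℝ × (Fin n → ℝ)) : stCurv Γ i j p = -stCurv Γ j i p :=
  dirCurv_swap _ _ _ _ _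

lemma stCov_stCurv_swap (l i j : Fin n) (p : ℝ × (Fin n → ℝ)) :
    stCov Γ l (stCurv Γ i j) p = -stCov Γ l (stCurv Γ j i) p := by
  have h : stCurv Γ i j = fun p => -stCurv Γ j i p := funext fun p => stCurv_swap i j p
  simp only [h, stCov, dirCov, fderiv_fun_neg, ← mbraL_apply, map_neg, neg_apply]
  abel

lemma stCov_stCurv_cyclic (h : IsSmoothConn Γ) (l i j : Fin n) (p : ℝ × (Fin n → ℝ)) :
    stCov Γ l (stCurv Γ i j) p + stCov Γ i (stCurv Γ j l) p + stCov Γ j (stCurv Γ l i) p = 0 :=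
  dirCov_dirCurv_cyclic (h.component l) (h.component i) (h.component j) _ _ _ _

/-- Evolution of the curvature, an instance of the Bianchi identity in space-time. -/
lemma fderiv_stCurv_time (h : IsSmoothConn Γ) (i j : Fin n) (p : ℝ × (Fin n → ℝ)) :
    fderiv ℝ (stCurv Γ i j) p (1, 0)
      = stCov Γ i (stVel Γ j) p - stCov Γ j (stVel Γ i) p := by
  have hB := dirCov_dirCurv_cyclic (contDiff_const (c := (0 : Mat k))) (h.component i)
    (h.component j) (1, 0) (0, Pi.single i 1) (0, Pi.single j 1) p
  have h0 : ∀ A : Mat k, mbra 0 A = 0 := fun A => by simp [← mbraL_apply]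
  have hr : ∀ A : Mat k, mbra A 0 = 0 := fun A => by simp [← mbraL_apply]
  have h1 : dirCurv (0, Pi.single j 1) (1, 0) (fun p => Γ p.1 p.2 j) (fun _ => (0 : Mat k))
      = fun p => -stVel Γ j p := by
    funext q
    simp [dirCurv, stVel, hr]
  have h2 : dirCurv (1, 0) (0, Pi.single i 1) (fun _ => (0 : Mat k)) (fun p => Γ p.1 p.2 i)
      = stVel Γ i := by
    funext q
    simp [dirCurv, stVel, h0]
  rw [h1, h2] at hB
  have h3 : dirCov (0, Pi.single i 1) (fun p => Γ p.1 p.2 i) (fun p => -stVel Γ j p) p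
      = -stCov Γ i (stVel Γ j) p := by
    simp only [stCov, dirCov, fderiv_fun_neg, ← mbraL_apply, map_neg, neg_apply]
    abel
  have h4 : dirCov (1, 0) (fun _ => (0 : Mat k)) (stCurv Γ i j) p
      = fderiv ℝ (stCurv Γ i j) p (1, 0) := by
    simp [dirCov, h0]
  rw [h3] at hB
  rw [← h4]
  refine sub_eq_zero.1 (Eq.trans ?_ hB)
  simp only [stCurv, stCov]
  abel

lemma hasDerivAt_minner {f g : ℝ → Mat k} {f' g' : Mat k} {s : ℝ} (hf : HasDerivAt f f' s)
    (hg : HasDerivAt g g' s) :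
    HasDerivAt (fun r => minner (f r) (g r)) (minner f' (g s) + minner (f s) g') s := by
  have h := ((minnerL k).hasFDerivAt_of_bilinear hf.hasFDerivAt hg.hasFDerivAt).hasDerivAt
  simpa [minnerL_apply, add_comm] using! h

/-- Metric compatibility of the covariant derivative. -/
lemma hasDerivAt_minner_cov {f g : ℝ → Mat k} {f' g' S : Mat k} {s : ℝ}
    (hS : ∀ a b, S b a = -S a b) (hf : HasDerivAt f f' s) (hg : HasDerivAt g g' s) :
    HasDerivAt (fun r => minner (f r) (g r))
      (minner (f' + mbra S (f s)) (g s) + minner (f s) (g' + mbra S (g s))) s := by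
  refine (hasDerivAt_minner hf hg).congr_deriv ?_
  rw [minner_add_left, minner_mbra_left hS, minner_comm (f s) (g' + _), minner_add_left,
    minner_comm g', minner_comm (mbra S (g s))]
  ring

end Flow

section Monotonicity

variable {n k : ℕ} {Γ : Conn n k} (x0 : Fin n → ℝ) (t0 : ℝ)

/-- The contraction `∑ₗ (x - x₀)ₗ F_{lj}` of the curvature with the position vector. -/
def radialCurv (Γ : Conn n k) (x0 : Fin n → ℝ) (t : ℝ) (j : Fin n) (x : Fin n → ℝ) : Mat k :=
  ∑ l, (x l - x0 l) • stCurv Γ l j (t, x)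

/-- The vector field whose weighted divergence appears in the monotonicity formula. -/
def flux (Γ : Conn n k) (x0 : Fin n → ℝ) (r t : ℝ) (i : Fin n) (x : Fin n → ℝ) : ℝ :=
  4 * ∑ j, minner (stCurv Γ i j (t, x)) (stVel Γ j (t, x))
    + r * (x i - x0 i) * ∑ a, ∑ b, msq (stCurv Γ a b (t, x))
    - 4 * r * ∑ j, minner (radialCurv Γ x0 t j x) (stCurv Γ i j (t, x))

lemma contDiff_flux (h : IsSmoothConn Γ) (r t : ℝ) (i : Fin n) :
    ContDiff ℝ ∞ (flux Γ x0 r t i) := by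
  have hslice : ContDiff ℝ ∞ fun x : Fin n → ℝ => (t, x) := contDiff_prodMk_right t
  have hF : ∀ a b, ContDiff ℝ ∞ fun x => stCurv Γ a b (t, x) :=
    fun a b => (h.stCurv a b).comp hslice
  have hE : ∀ b, ContDiff ℝ ∞ fun x => stVel Γ b (t, x) := fun b => (h.stVel b).comp hslice
  have hR : ∀ j, ContDiff ℝ ∞ (radialCurv Γ x0 t j) :=
    fun j => ContDiff.sum fun l _ =>
      ContDiff.smul (f := fun x : Fin n → ℝ => x l - x0 l) (by fun_prop) (hF l j)
  exact ((contDiff_const.mul (ContDiff.sum fun j _ => (hF i j).minner (hE j))).add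
    (ContDiff.mul (by fun_prop)
      (ContDiff.sum fun a _ => ContDiff.sum fun b _ => (hF a b).minner (hF a b)))).sub
    (contDiff_const.mul (ContDiff.sum fun j _ => (hR j).minner (hF i j)))

lemma flux_eq_zero {K : Set (Fin n → ℝ)} (hK : IsCompact K) (hs : SuppIn Γ K)
    (h : IsSmoothConn Γ) (r t : ℝ) (i : Fin n) {x : Fin n → ℝ} (hx : x ∉ K) :
    flux Γ x0 r t i x = 0 := by
  simp [flux, msq, stCurv_eq_zero hK hs h t hx, ← minnerL_apply]

lemma hasDerivAt_slice_line {om : ℝ × (Fin n → ℝ) → Mat k} (hom : ContDiff ℝ ∞ om) (t : ℝ)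
    (x : Fin n → ℝ) (i : Fin n) :
    HasDerivAt (fun s : ℝ => om (t, x + s • Pi.single i 1))
      (fderiv ℝ om (t, x) (0, Pi.single i 1)) 0 := by
  simpa using! hasDerivAt_line (hom.differentiable (by simp) (t, x)) (0, Pi.single i 1)

lemma hasDerivAt_radialCurv (h : IsSmoothConn Γ) (t : ℝ) (x : Fin n → ℝ) (i j : Fin n) :
    HasDerivAt (fun s : ℝ => radialCurv Γ x0 t j (x + s • Pi.single i 1))
      (stCurv Γ i j (t, x)
        + ∑ l, (x l - x0 l) • fderiv ℝ (stCurv Γ l j) (t, x) (0, Pi.single i 1)) 0 := by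
  have hx : ∀ l, HasDerivAt (fun s : ℝ => (x + s • (Pi.single i 1 : Fin n → ℝ)) l - x0 l)
      ((Pi.single i (1 : ℝ) : Fin n → ℝ) l) 0 := by
    intro l
    simpa using! (((hasDerivAt_id (0 : ℝ)).mul_const
      ((Pi.single i (1 : ℝ) : Fin n → ℝ) l)).const_add (x l)).sub_const (x0 l)
  refine (HasDerivAt.fun_sum fun l (_ : l ∈ Finset.univ) =>
    (hx l).smul (hasDerivAt_slice_line (h.stCurv l j) t x i)).congr_deriv ?_
  simp [Finset.sum_add_distrib, Pi.single_apply, add_comm]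

lemma hasDerivAt_flux (h : IsSmoothConn Γ) (r t : ℝ) (i : Fin n) (x : Fin n → ℝ) :
    HasDerivAt (fun s : ℝ => flux Γ x0 r t i (x + s • Pi.single i 1))
      (4 * ∑ j, (minner (stCov Γ i (stCurv Γ i j) (t, x)) (stVel Γ j (t, x))
          + minner (stCurv Γ i j (t, x)) (stCov Γ i (stVel Γ j) (t, x)))
        + (r * ∑ a, ∑ b, msq (stCurv Γ a b (t, x))
          + r * (x i - x0 i) * ∑ a, ∑ b, (minner (stCov Γ i (stCurv Γ a b) (t, x))
              (stCurv Γ a b (t, x))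
            + minner (stCurv Γ a b (t, x)) (stCov Γ i (stCurv Γ a b) (t, x))))
        - 4 * r * ∑ j, (minner (stCurv Γ i j (t, x)
              + ∑ l, (x l - x0 l) • stCov Γ i (stCurv Γ l j) (t, x)) (stCurv Γ i j (t, x))
            + minner (∑ l, (x l - x0 l) • stCurv Γ l j (t, x))
              (stCov Γ i (stCurv Γ i j) (t, x)))) 0 := by
  have hS := h.2 t x i
  have hF := fun a b => hasDerivAt_slice_line (h.stCurv a b) t x i
  have hE := fun b => hasDerivAt_slice_line (h.stVel b) t x i
  have hR := fun j => hasDerivAt_radialCurv x0 h t x i j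
  have hx : HasDerivAt (fun s : ℝ => (x + s • (Pi.single i 1 : Fin n → ℝ)) i - x0 i) 1 0 := by
    simpa using! ((hasDerivAt_id (0 : ℝ)).const_add (x i)).sub_const (x0 i)
  have h1 := (HasDerivAt.fun_sum fun j (_ : j ∈ Finset.univ) =>
    hasDerivAt_minner_cov hS (hF i j) (hE j)).const_mul 4
  have h2 := (hx.const_mul r).mul (HasDerivAt.fun_sum fun a (_ : a ∈ Finset.univ) =>
    HasDerivAt.fun_sum fun b (_ : b ∈ Finset.univ) => hasDerivAt_minner_cov hS (hF a b) (hF a b))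
  have h3 := (HasDerivAt.fun_sum fun j (_ : j ∈ Finset.univ) =>
    hasDerivAt_minner_cov hS (hR j) (hF i j)).const_mul (4 * r)
  refine ((h1.add h2).sub h3).congr_deriv ?_
  have hcov : ∀ j, stCurv Γ i j (t, x)
        + ∑ l, (x l - x0 l) • fderiv ℝ (stCurv Γ l j) (t, x) (0, Pi.single i 1)
        + mbra (Γ t x i) (radialCurv Γ x0 t j x)
      = stCurv Γ i j (t, x) + ∑ l, (x l - x0 l) • stCov Γ i (stCurv Γ l j) (t, x) := by
    intro j
    simp only [radialCurv, stCov, dirCov, ← mbraL_apply, map_sum, map_smul, smul_add,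
      Finset.sum_add_distrib, add_assoc]
  simp only [zero_smul, add_zero, hcov, mul_one]
  rfl

/-- The entropy density `τ² |F|² G` with `τ = t₀ - t`. -/
def entropyDensity (Γ : Conn n k) (x0 : Fin n → ℝ) (t0 : ℝ) (p : ℝ × (Fin n → ℝ)) : ℝ :=
  (t0 - p.1) ^ 2 * (normF2 Γ p.1 p.2 * gauss (x0, t0) p.2 p.1)

lemma contDiffOn_entropyDensity (h : IsSmoothConn Γ) :
    ContDiffOn ℝ ∞ (entropyDensity Γ x0 t0) (Iio t0 ×ˢ univ) := by
  have hN : ContDiff ℝ ∞ fun p : ℝ × (Fin n → ℝ) => normF2 Γ p.1 p.2 := by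
    simp only [normF2_eq h]
    exact ContDiff.sum fun a _ => ContDiff.sum fun b _ => (h.stCurv a b).minner (h.stCurv a b)
  exact ContDiffOn.mul (by fun_prop) (hN.contDiffOn.mul (contDiffOn_gauss x0 t0))

lemma entropyDensity_eq_zero {K : Set (Fin n → ℝ)} (hK : IsCompact K) (hs : SuppIn Γ K)
    (h : IsSmoothConn Γ) (t : ℝ) {x : Fin n → ℝ} (hx : x ∉ K) :
    entropyDensity Γ x0 t0 (t, x) = 0 := by
  simp [entropyDensity, normF2_eq h, stCurv_eq_zero hK hs h t hx, msq, ← minnerL_apply]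

lemma hasDerivAt_normF2 (h : IsSmoothConn Γ) (t : ℝ) (x : Fin n → ℝ) :
    HasDerivAt (fun s => normF2 Γ s x)
      (2 * ∑ i, ∑ j, minner (stCurv Γ i j (t, x))
        (stCov Γ i (stVel Γ j) (t, x) - stCov Γ j (stVel Γ i) (t, x))) t := by
  have hF := fun i j => hasDerivAt_slice_left ((h.stCurv i j).differentiable (by simp) (t, x))
  have h1 := HasDerivAt.fun_sum fun i (_ : i ∈ Finset.univ) =>
    HasDerivAt.fun_sum fun j (_ : j ∈ Finset.univ) => hasDerivAt_minner (hF i j) (hF i j)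
  simp only [normF2_eq h]
  refine h1.congr_deriv ?_
  simp only [fderiv_stCurv_time h, minner_comm _ (stCurv Γ _ _ (t, x)), ← two_mul,
    ← Finset.mul_sum]

/-- Pointwise form of the monotonicity formula. -/
lemma fderiv_entropyDensity (h : IsSmoothConn Γ) {I : Set ℝ} (hflow : IsYMFlowOn Γ I) {t : ℝ}
    (ht : t ∈ I) (ht0 : t < t0) (x : Fin n → ℝ) :
    fderiv ℝ (entropyDensity Γ x0 t0) (t, x) (1, 0)
      = ∑ i, fderiv ℝ (fun y => (t0 - t) ^ 2 *
          (gauss (x0, t0) y t * flux Γ x0 (1 / (2 * (t0 - t))) t i y)) x (Pi.single i 1)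
        - (t0 - t) ^ 2 * (gauss (x0, t0) x t * (4 * ∑ j, msq (stVel Γ j (t, x)
          - (1 / (2 * (t0 - t))) • radialCurv Γ x0 t j x))) := by
  have hτ : 0 < t0 - t := sub_pos.2 ht0
  have hmem : Iio t0 ×ˢ univ ∈ nhds (t, x) :=
    (isOpen_Iio.prod isOpen_univ).mem_nhds ⟨ht0, mem_univ x⟩
  have hd : DifferentiableAt ℝ (entropyDensity Γ x0 t0) (t, x) :=
    ((contDiffOn_entropyDensity x0 t0 h).contDiffAt hmem).differentiableAt (by simp)
  have hsub : HasDerivAt (fun s => (t0 - s) ^ 2) (-(2 * (t0 - t))) t := by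
    simpa using! ((hasDerivAt_id t).const_sub t0).pow 2
  have htime := (hasDerivAt_slice_left hd).unique
    (hsub.mul ((hasDerivAt_normF2 h t x).mul (hasDerivAt_gauss_time x0 t0 ht0 x)))
  have hG := contDiff_gauss_slice x0 t0 ht0
  have hspace := fun i => (hasDerivAt_line (f := fun y => (t0 - t) ^ 2 *
      (gauss (x0, t0) y t * flux Γ x0 (1 / (2 * (t0 - t))) t i y)) (p := x)
      ((contDiff_const.mul (hG.mul (contDiff_flux x0 h _ t i))).differentiable (by simp) x)
      (Pi.single i 1)).unique
    (((hasDerivAt_gauss_line x0 t0 ht0 x i).mul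
      (hasDerivAt_flux x0 h (1 / (2 * (t0 - t))) t i x)).const_mul ((t0 - t) ^ 2))
  have halg := sum_divergence_eq (F := fun i j => stCurv Γ i j (t, x))
    (dE := fun i j => stCov Γ i (stVel Γ j) (t, x)) (E := fun j => stVel Γ j (t, x))
    (dF := fun l i j => stCov Γ l (stCurv Γ i j) (t, x)) (fun i => x i - x0 i)
    (1 / (2 * (t0 - t))) (fun i j => stCurv_swap i j _) (fun l i j => stCov_stCurv_swap l i j _)
    (fun l i j => stCov_stCurv_cyclic h l i j _) (fun j => hflow.stVel_eq h ht x j)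
  rw [htime]
  simp only [hspace, zero_smul, add_zero]
  have hsum : ∀ a b : Fin n → ℝ,
      ∑ i, (t0 - t) ^ 2 * (gauss (x0, t0) x t * -((x i - x0 i) / (2 * (t0 - t))) * a i
        + gauss (x0, t0) x t * b i)
      = (t0 - t) ^ 2 * gauss (x0, t0) x t *
        ∑ i, (b i - 1 / (2 * (t0 - t)) * (x i - x0 i) * a i) := by
    intro a b
    rw [Finset.mul_sum]
    refine Finset.sum_congr rfl fun i _ => ?_
    field_simp
    ring
  rw [hsum]
  simp only [flux, radialCurv] at halg ⊢
  rw [halg, normF2_eq h]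
  field_simp
  ring

/-- The weighted energy `τ² ∫ |F|² G`. -/
def weightedEnergy (Γ : Conn n k) (x0 : Fin n → ℝ) (t0 t : ℝ) : ℝ :=
  ∫ x, entropyDensity Γ x0 t0 (t, x)

lemma weightedEnergy_eq (t : ℝ) : weightedEnergy Γ x0 t0 t
    = (t0 - t) ^ 2 * ∫ x : Fin n → ℝ, normF2 Γ t x * gauss (x0, t0) x t := by
  simp only [weightedEnergy, entropyDensity, integral_const_mul]

lemma weightedEnergy_nonneg {t : ℝ} (ht : t < t0) : 0 ≤ weightedEnergy Γ x0 t0 t :=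
  integral_nonneg fun x => mul_nonneg (sq_nonneg _) (mul_nonneg
    (Finset.sum_nonneg fun _ _ => Finset.sum_nonneg fun _ _ => msq_nonneg _)
    (gauss_pos x0 t0 ht x).le)

lemma hasDerivAt_weightedEnergy (h : IsSmoothConn Γ) {K : Set (Fin n → ℝ)} (hK : IsCompact K)
    (hs : SuppIn Γ K) {t : ℝ} (ht : t < t0) :
    Integrable (fun x => fderiv ℝ (entropyDensity Γ x0 t0) (t, x) (1, 0)) ∧
      HasDerivAt (weightedEnergy Γ x0 t0)
        (∫ x, fderiv ℝ (entropyDensity Γ x0 t0) (t, x) (1, 0)) t :=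
  hasDerivAt_integral_of_contDiffOn volume isOpen_Iio
    ((contDiffOn_entropyDensity x0 t0 h).of_le (by simp)) hK
    (fun t _ hx => entropyDensity_eq_zero x0 t0 hK hs h t hx) ht

/-- Monotonicity formula for the Yang-Mills flow. -/
lemma antitoneOn_weightedEnergy (h : IsSmoothConn Γ) {T : ℝ} (hflow : IsYMFlowOn Γ (Ico 0 T))
    {K : Set (Fin n → ℝ)} (hK : IsCompact K) (hs : SuppIn Γ K) (hT : t0 ≤ T) :
    AntitoneOn (weightedEnergy Γ x0 t0) (Ioo 0 t0) := by
  have hderiv := fun (t : ℝ) (ht : t < t0) => hasDerivAt_weightedEnergy x0 t0 h hK hs ht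
  refine antitoneOn_of_deriv_nonpos (convex_Ioo 0 t0)
    (fun t ht => (hderiv t ht.2).2.continuousAt.continuousWithinAt)
    (fun t ht => (hderiv t (interior_subset ht).2).2.differentiableAt.differentiableWithinAt) ?_
  intro t ht
  rw [interior_Ioo] at ht
  have hG := contDiff_gauss_slice x0 t0 ht.2
  have hV : ∀ i, ContDiff ℝ 1 fun y => (t0 - t) ^ 2 *
      (gauss (x0, t0) y t * flux Γ x0 (1 / (2 * (t0 - t))) t i y) := fun i =>
    (contDiff_const.mul (hG.mul (contDiff_flux x0 h _ t i))).of_le (by simp)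
  have hVc : ∀ i, HasCompactSupport fun y => (t0 - t) ^ 2 *
      (gauss (x0, t0) y t * flux Γ x0 (1 / (2 * (t0 - t))) t i y) := fun i =>
    HasCompactSupport.intro hK fun y hy => by simp [flux_eq_zero x0 hK hs h _ t i hy]
  have hVi : ∀ i ∈ Finset.univ, Integrable fun y => fderiv ℝ (fun y => (t0 - t) ^ 2 *
      (gauss (x0, t0) y t * flux Γ x0 (1 / (2 * (t0 - t))) t i y)) y (Pi.single i 1) :=
    fun i _ => (((hV i).continuous_fderiv (by simp)).clm_apply
      continuous_const).integrable_of_hasCompactSupport ((hVc i).fderiv_apply (𝕜 := ℝ) _)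
  rw [(hderiv t ht.2).2.deriv]
  refine (integral_mono (hderiv t ht.2).1 (integrable_finsetSum _ hVi) fun x => ?_).trans_eq ?_
  · simp only
    rw [fderiv_entropyDensity x0 t0 h hflow ⟨ht.1.le, ht.2.trans_le hT⟩ ht.2]
    have : 0 ≤ ∑ j, msq (stVel Γ j (t, x) - (1 / (2 * (t0 - t))) • radialCurv Γ x0 t j x) :=
      Finset.sum_nonneg fun _ _ => msq_nonneg _
    have := gauss_pos x0 t0 ht.2 x
    exact sub_le_self _ (by positivity)
  · rw [integral_finsetSum _ hVi]
    exact Finset.sum_eq_zero fun i _ => integral_fderiv_eq_zero volume (hV i) (hVc i) _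

end Monotonicity

lemma Phi_eq_weightedEnergy {n k : ℕ} (Γ : Conn n k) (x0 : Fin n → ℝ) (t0 R : ℝ) :
    Phi Γ (x0, t0) R = weightedEnergy Γ x0 t0 (t0 - R ^ 2) / 2 := by
  rw [weightedEnergy_eq, Phi]
  ring

/-- Uniform comparability of the two entropies: there is `C = C(n) ≥ 1` such
that for every compactly supported smooth solution of Yang–Mills flow and `0 < 2R < √t₀/2`,
`Ψ_{z₀}(R;Γ) ≤ C Φ_{z₀}(2R;Γ)` and `Φ_{z₀}(R;Γ) ≤ C Ψ_{z₀}(R;Γ)`. -/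
theorem entropy_comparison
    (n : ℕ) (hn : 2 ≤ n) :
    ∃ C : ℝ, 1 ≤ C ∧ ∀ (k : ℕ) (T : ℝ) (Γ : Conn n k),
      IsSmoothConn Γ → IsYMFlowOn Γ (Ico 0 T) →
      (∃ K : Set (Fin n → ℝ), IsCompact K ∧ SuppIn Γ K) →
      ∀ (x0 : Fin n → ℝ) (t0 : ℝ), t0 ∈ Ioo 0 T →
        ∀ R : ℝ, 0 < R → 2 * R < Real.sqrt t0 / 2 →
          Psi Γ (x0, t0) R ≤ C * Phi Γ (x0, t0) (2 * R)
            ∧ Phi Γ (x0, t0) R ≤ C * Psi Γ (x0, t0) R := by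
  refine ⟨6, by norm_num, ?_⟩
  rintro k T Γ h hflow ⟨K, hK, hs⟩ x0 t0 ht0 R hR hR'
  have hRt : 4 * R ^ 2 < t0 := by
    have h1 := Real.sq_sqrt ht0.1.le
    nlinarith
  have hR2 : 0 < R ^ 2 := by positivity
  set Z := weightedEnergy Γ x0 t0
  set I := Icc (t0 - 4 * R ^ 2) (t0 - R ^ 2)
  have hanti : AntitoneOn Z (Ioo 0 t0) :=
    antitoneOn_weightedEnergy x0 t0 h hflow hK hs ht0.2.le
  have hI : ∀ t ∈ I, t ∈ Ioo 0 t0 := fun t ht => ⟨by linarith [ht.1], by linarith [ht.2]⟩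
  have hl : t0 - 4 * R ^ 2 ∈ I := left_mem_Icc.2 (by linarith)
  have hr : t0 - R ^ 2 ∈ I := right_mem_Icc.2 (by linarith)
  have hZ : ∀ t ∈ I, 0 ≤ Z t := fun t ht => weightedEnergy_nonneg x0 t0 (hI t ht).2
  have hinner : ∀ t ∈ I, ∫ x : Fin n → ℝ, normF2 Γ t x * gauss (x0, t0) x t
      = Z t / (t0 - t) ^ 2 := by
    intro t ht
    have : t0 - t ≠ 0 := (sub_pos.2 (hI t ht).2).ne'
    rw [show Z t = _ from weightedEnergy_eq x0 t0 t]
    field_simp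
  have hPsi : Psi Γ (x0, t0) R = R ^ 2 / 2 * ∫ t in I, Z t / (t0 - t) ^ 2 := by
    rw [Psi, setIntegral_congr_fun measurableSet_Icc hinner]
  have hint : IntegrableOn (fun t => Z t / (t0 - t) ^ 2) I := by
    refine ContinuousOn.integrableOn_compact isCompact_Icc (ContinuousOn.div (fun t ht =>
      (hasDerivAt_weightedEnergy x0 t0 h hK hs (hI t ht).2).2.continuousAt.continuousWithinAt)
      (by fun_prop) fun t ht => ?_)
    exact pow_ne_zero 2 (sub_pos.2 (hI t ht).2).ne'
  have hconst : ∀ c : ℝ, ∫ _ in I, c = 3 * R ^ 2 * c := by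
    intro c
    rw [setIntegral_const, Real.volume_real_Icc_of_le (by linarith), smul_eq_mul]
    ring
  have hci : ∀ c : ℝ, IntegrableOn (fun _ : ℝ => c) I := fun c =>
    integrableOn_const isCompact_Icc.measure_lt_top.ne
  have hupper : ∫ t in I, Z t / (t0 - t) ^ 2 ≤ 3 * R ^ 2 * (Z (t0 - 4 * R ^ 2) / (R ^ 2) ^ 2) := by
    rw [← hconst]
    refine setIntegral_mono_on hint (hci _) measurableSet_Icc fun t ht => ?_
    have := hZ _ hl
    have h1 : R ^ 2 ≤ t0 - t := by linarith [ht.2]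
    gcongr
    exact hanti (hI _ hl) (hI _ ht) ht.1
  have hlower : 3 * R ^ 2 * (Z (t0 - R ^ 2) / (4 * R ^ 2) ^ 2) ≤ ∫ t in I, Z t / (t0 - t) ^ 2 := by
    rw [← hconst]
    refine setIntegral_mono_on (hci _) hint measurableSet_Icc fun t ht => ?_
    have := hZ _ ht
    have h1 : 0 < t0 - t := sub_pos.2 (hI t ht).2
    have h2 : t0 - t ≤ 4 * R ^ 2 := by linarith [ht.1]
    gcongr
    exact hanti (hI _ ht) (hI _ hr) ht.2
  rw [hPsi, Phi_eq_weightedEnergy, Phi_eq_weightedEnergy, mul_pow, show (2 : ℝ) ^ 2 = 4 by norm_num]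
  constructor
  · calc _ ≤ R ^ 2 / 2 * (3 * R ^ 2 * (Z (t0 - 4 * R ^ 2) / (R ^ 2) ^ 2)) := by gcongr
      _ = 3 / 2 * Z (t0 - 4 * R ^ 2) := by field_simp
      _ ≤ 6 * (Z (t0 - 4 * R ^ 2) / 2) := by linarith [hZ _ hl]
  · calc _ ≤ 9 / 16 * Z (t0 - R ^ 2) := by linarith [hZ _ hr]
      _ = 6 * (R ^ 2 / 2 * (3 * R ^ 2 * (Z (t0 - R ^ 2) / (4 * R ^ 2) ^ 2))) := by
        field_simp
        ring
      _ ≤ _ := by gcongr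

end
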